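/- For every constant C ≥ 2 there exists ε₀ ∈ (0,1), depending only on C, with the following property. Let ε ∈ (0, ε₀), let Q be a dyadic cube, let w ∈ ℂᵐ with |w| = 1, let b ∈ L²(ℝⁿ, ℂᵐ), and let F : ℂᵐ → ℝ be a real-linear map with |F(v)| ≤ |v| for all v ∈ ℂᵐ. Assume ∫_Q |w − b|² ≤ C|Q| and F(w − (1/|Q|)∫_Q b) ≤ C√ε. Then Q contains a family of pairwise disjoint dyadic subcubes Q_i such that Σ_i |Q_i| ≤ (1−ε)|Q|, and for every (x,t) ∈ R(Q) ∖ ∪_i R(Q_i) one has F(w − (S_t b)(x)) ≤ 10C√ε and |w − (S_t b)(x)| ≤ √(C/ε). -/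

import Mathlib

open MeasureTheory
open scoped ENNReal NNReal

noncomputable section

abbrev Edom (n : ℕ) := EuclideanSpace ℝ (Fin n)
abbrev Erng (m : ℕ) := EuclideanSpace ℂ (Fin m)
abbrev HS (n m : ℕ) := MeasureTheory.Lp (E := Erng m) 2 (volume : Measure (Edom n))

/-- The dyadic cube `2^j (z + (0,1]^n)`. -/
def dyCube (n : ℕ) (j : ℤ) (z : Fin n → ℤ) : Set (Edom n) :=
  {x | ∀ i, x i ∈ Set.Ioc ((2 : ℝ) ^ j * z i) ((2 : ℝ) ^ j * (z i + 1))}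

/-- The dyadic generation index of `t`: the unique `j ∈ ℤ` with `2^{j-1} < t ≤ 2^j`. -/
def dyIdx (t : ℝ) : ℤ := ⌈Real.logb 2 t⌉

/-- The index of the unique dyadic cube of generation `j` containing `x`. -/
def ptIdx (n : ℕ) (j : ℤ) (x : Edom n) : Fin n → ℤ := fun i => ⌈x i / (2 : ℝ) ^ j⌉ - 1

/-- The dyadic averaging operator `S_t`. -/
def Savg {n m : ℕ} (t : ℝ) (f : Edom n → Erng m) (x : Edom n) : Erng m :=
  (volume (dyCube n (dyIdx t) (ptIdx n (dyIdx t) x))).toReal⁻¹ •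
    ∫ y in dyCube n (dyIdx t) (ptIdx n (dyIdx t) x), f y

/-- The Carleson box `R(Q) = Q × (0, l(Q)]` of a dyadic cube, as a subset of `ℝⁿ × ℝ`. -/
def carlesonBox (n : ℕ) (j : ℤ) (z : Fin n → ℤ) : Set (Edom n × ℝ) :=
  {p | p.1 ∈ dyCube n j z ∧ p.2 ∈ Set.Ioc (0 : ℝ) ((2 : ℝ) ^ j)}

theorem mem_dyCube_iff {n : ℕ} {j : ℤ} {z : Fin n → ℤ} {x : Edom n} :
    x ∈ dyCube n j z ↔ ptIdx n j x = z := by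
  have h2 : (0 : ℝ) < 2 ^ j := by positivity
  simp only [dyCube, ptIdx, Set.mem_ofPred_eq, Set.mem_Ioc, funext_iff]
  refine forall_congr' fun i => ?_
  rw [sub_eq_iff_eq_add, Int.ceil_eq_iff, lt_div_iff₀ h2, div_le_iff₀ h2]
  push_cast
  rw [add_sub_cancel_right, mul_comm (2 ^ j : ℝ), mul_comm (2 ^ j : ℝ)]

theorem dyCube_subset_of_mem {n : ℕ} {k j : ℤ} (hkj : k ≤ j) {y z : Fin n → ℤ} {x : Edom n}
    (hy : x ∈ dyCube n k y) (hz : x ∈ dyCube n j z) : dyCube n k y ⊆ dyCube n j z := by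
  obtain ⟨d, rfl⟩ := Int.le.dest hkj
  intro u hu i
  have h2 : (0 : ℝ) < 2 ^ k := by positivity
  have hpow : (2 : ℝ) ^ (k + (d : ℤ)) = 2 ^ k * ((2 ^ d : ℤ) : ℝ) := by
    rw [zpow_add₀ two_ne_zero]; simp
  obtain ⟨a1, a2⟩ := hy i
  obtain ⟨b1, b2⟩ := hz i
  obtain ⟨c1, c2⟩ := hu i
  rw [hpow, mul_assoc] at b1 b2
  have e1 : 2 ^ d * z i < y i + 1 := by
    have := lt_of_mul_lt_mul_left (b1.trans_le a2) h2.le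
    exact_mod_cast this
  have e2 : y i < 2 ^ d * (z i + 1) := by
    have := lt_of_mul_lt_mul_left (a1.trans_le b2) h2.le
    exact_mod_cast this
  have f1 : ((2 ^ d * z i : ℤ) : ℝ) ≤ y i := by exact_mod_cast Int.lt_add_one_iff.1 e1
  have f2 : ((y i + 1 : ℤ) : ℝ) ≤ ((2 ^ d * (z i + 1) : ℤ) : ℝ) := by exact_mod_cast e2
  rw [hpow, mul_assoc, mul_assoc]
  constructor
  · refine lt_of_le_of_lt (mul_le_mul_of_nonneg_left ?_ h2.le) c1
    exact_mod_cast f1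
  · refine c2.trans (mul_le_mul_of_nonneg_left ?_ h2.le)
    exact_mod_cast f2

/-- The maximal dyadic subcubes of a given cube that satisfy `P`. -/
theorem exists_maximal_dyCubes (n : ℕ) (j : ℤ) (z : Fin n → ℤ)
    (P : ℤ → (Fin n → ℤ) → Prop) :
    ∃ S : Set (ℤ × (Fin n → ℤ)),
      (∀ p ∈ S, dyCube n p.1 p.2 ⊆ dyCube n j z) ∧
      (∀ p ∈ S, ∀ q ∈ S, p ≠ q → Disjoint (dyCube n p.1 p.2) (dyCube n q.1 q.2)) ∧
      (∀ p ∈ S, P p.1 p.2) ∧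
      ∀ (x : Edom n) (t : ℝ), x ∈ dyCube n j z → t ∈ Set.Ioc (0 : ℝ) ((2 : ℝ) ^ j) →
        (x, t) ∉ ⋃ q ∈ S, carlesonBox n q.1 q.2 → ¬ P (dyIdx t) (ptIdx n (dyIdx t) x) := by
  refine ⟨{p | p.1 ≤ j ∧ dyCube n p.1 p.2 ⊆ dyCube n j z ∧ P p.1 p.2 ∧
    ∀ k y, p.1 < k → k ≤ j → dyCube n p.1 p.2 ⊆ dyCube n k y → ¬ P k y},
    fun p hp => hp.2.1, ?_, fun p hp => hp.2.2.1, ?_⟩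
  · intro p hp q hq hpq
    rw [Set.disjoint_left]
    intro x hxp hxq
    rcases lt_trichotomy p.1 q.1 with h | h | h
    · exact hp.2.2.2 _ _ h hq.1 (dyCube_subset_of_mem h.le hxp hxq) hq.2.2.1
    · refine hpq (Prod.ext h ?_)
      rw [← mem_dyCube_iff.1 hxp, ← mem_dyCube_iff.1 hxq, h]
    · exact hq.2.2.2 _ _ h hp.1 (dyCube_subset_of_mem h.le hxq hxp) hp.2.2.1
  · intro x t hx ht hxt hP
    have hxk (k : ℤ) : x ∈ dyCube n k (ptIdx n k x) := mem_dyCube_iff.2 rfl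
    have hkj : dyIdx t ≤ j := by
      rw [dyIdx, Int.ceil_le, Real.logb_le_iff_le_rpow one_lt_two ht.1]
      exact_mod_cast ht.2
    obtain ⟨K, ⟨⟨hkK, hKj⟩, hPK⟩, hmax⟩ := Int.exists_greatest_of_bdd
      (P := fun k => (dyIdx t ≤ k ∧ k ≤ j) ∧ P k (ptIdx n k x))
      ⟨j, fun k hk => hk.1.2⟩ ⟨dyIdx t, ⟨le_rfl, hkj⟩, hP⟩
    refine hxt (Set.mem_biUnion (x := (K, ptIdx n K x))
      ⟨hKj, dyCube_subset_of_mem hKj (hxk K) hx, hPK, ?_⟩ ⟨hxk K, ht.1, ?_⟩)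
    · intro k y hKk hk hsub hPk
      rw [← mem_dyCube_iff.1 (hsub (hxk K))] at hPk
      exact (hmax k ⟨⟨hkK.trans hKk.le, hk⟩, hPk⟩).not_gt hKk
    · have h1 : Real.logb 2 t ≤ (K : ℝ) := (Int.le_ceil _).trans (by exact_mod_cast hkK)
      rw [Real.logb_le_iff_le_rpow one_lt_two ht.1] at h1
      exact_mod_cast h1

theorem dyCube_eq_preimage (n : ℕ) (j : ℤ) (z : Fin n → ℤ) :
    dyCube n j z = (WithLp.ofLp : Edom n → Fin n → ℝ) ⁻¹' Set.univ.pi fun i =>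
      Set.Ioc ((2 : ℝ) ^ j * z i) ((2 : ℝ) ^ j * (z i + 1)) := by
  ext x; simp [dyCube]

theorem measurableSet_dyCube (n : ℕ) (j : ℤ) (z : Fin n → ℤ) : MeasurableSet (dyCube n j z) := by
  rw [dyCube_eq_preimage]
  exact (PiLp.volume_preserving_ofLp (Fin n)).measurable
    (MeasurableSet.univ_pi fun i => measurableSet_Ioc)

theorem volume_dyCube (n : ℕ) (j : ℤ) (z : Fin n → ℤ) :
    volume (dyCube n j z) = ENNReal.ofReal (2 ^ j) ^ n := by
  rw [dyCube_eq_preimage, (PiLp.volume_preserving_ofLp (Fin n)).measure_preimage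
    (MeasurableSet.univ_pi fun i => measurableSet_Ioc).nullMeasurableSet, Real.volume_pi_Ioc]
  simp [mul_add]

theorem volume_dyCube_ne_top (n : ℕ) (j : ℤ) (z : Fin n → ℤ) : volume (dyCube n j z) ≠ ∞ := by
  rw [volume_dyCube]; exact ENNReal.pow_ne_top ENNReal.ofReal_ne_top

theorem measureReal_dyCube_pos (n : ℕ) (j : ℤ) (z : Fin n → ℤ) :
    0 < (volume (dyCube n j z)).toReal := by
  rw [volume_dyCube, ENNReal.toReal_pow, ENNReal.toReal_ofReal (by positivity)]
  positivity

/-- The Cauchy–Schwarz inequality for `‖g‖` against the constant function `1`. -/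
theorem sq_integral_norm_le {α E : Type*} [MeasurableSpace α] {μ : Measure α} [IsFiniteMeasure μ]
    [NormedAddCommGroup E] {g : α → E} (hg : MemLp g 2 μ) :
    (∫ x, ‖g x‖ ∂μ) ^ 2 ≤ μ.real Set.univ * ∫ x, ‖g x‖ ^ 2 ∂μ := by
  have hsq : Integrable (fun x => ‖g x‖ ^ 2) μ := hg.integrable_norm_pow two_ne_zero
  have hint : Integrable (fun x => ‖g x‖) μ := (hg.integrable one_le_two).norm
  rcases eq_or_ne μ 0 with rfl | hμ
  · simp
  have hc : 0 < μ.real Set.univ := by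
    have : NeZero μ := ⟨hμ⟩
    exact measureReal_univ_pos
  set c := μ.real Set.univ with hc_def
  set d := ∫ x, ‖g x‖ ∂μ with hd
  have h0 : 0 ≤ ∫ x, (c * ‖g x‖ - d) ^ 2 ∂μ := integral_nonneg fun x => sq_nonneg _
  have h1 : ∫ x, (c * ‖g x‖ - d) ^ 2 ∂μ = c * (c * ∫ x, ‖g x‖ ^ 2 ∂μ - d ^ 2) := by
    have : (fun x => (c * ‖g x‖ - d) ^ 2) =
        fun x => (c ^ 2 * ‖g x‖ ^ 2 - 2 * c * d * ‖g x‖) + d ^ 2 := by ext x; ring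
    have hlin : Integrable (fun x => c ^ 2 * ‖g x‖ ^ 2 - 2 * c * d * ‖g x‖) μ :=
      (hsq.const_mul _).sub (hint.const_mul _)
    rw [this, integral_add hlin (integrable_const _),
      integral_sub (hsq.const_mul _) (hint.const_mul _), integral_const_mul, integral_const_mul,
      integral_const, ← hd, ← hc_def, smul_eq_mul]
    ring
  rw [h1] at h0
  linarith [nonneg_of_mul_nonneg_right h0 hc]

theorem mul_measureReal_iUnion_le {α ι : Type*} [MeasurableSpace α] {μ : Measure α} [Countable ι]
    {A : ι → Set α} (hA : ∀ i, MeasurableSet (A i)) (hd : Pairwise (Function.onFun Disjoint A))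
    (hfin : μ (⋃ i, A i) ≠ ∞) {f : α → ℝ} (hf : IntegrableOn f (⋃ i, A i) μ) {c : ℝ}
    (h : ∀ i, c * μ.real (A i) ≤ ∫ x in A i, f x ∂μ) :
    c * μ.real (⋃ i, A i) ≤ ∫ x in ⋃ i, A i, f x ∂μ := by
  have h1 := hasSum_integral_iUnion (μ := μ) (f := fun _ => c) hA hd
    (integrableOn_const hfin)
  have h2 := hasSum_integral_iUnion hA hd hf
  have := hasSum_le (fun i => ?_) h1 h2
  · simpa [mul_comm] using this
  · simpa [mul_comm] using h i

/-- Packing estimate: disjoint subsets of `Q` on each of which either the mean of `F ∘ g` or the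
mean of `‖g‖²` is large cannot fill more than the proportion `1 - ε` of `Q`. -/
theorem measureReal_iUnion_le_of_stopping {α ι E : Type*} [MeasurableSpace α] {μ : Measure α}
    [Countable ι] [NormedAddCommGroup E] [NormedSpace ℝ E] [CompleteSpace E]
    {Q : Set α} (hQfin : μ Q ≠ ∞)
    {g : α → E} (hg : MemLp g 2 (μ.restrict Q)) {C ε : ℝ} (hC : 2 ≤ C) (hε : 0 < ε)
    (hε' : ε < 1 / 4) (hgC : ∫ x in Q, ‖g x‖ ^ 2 ∂μ ≤ C * μ.real Q)
    (F : E →L[ℝ] ℝ) (hF : ∀ v, |F v| ≤ ‖v‖)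
    (hFQ : ∫ x in Q, F (g x) ∂μ ≤ C * √ε * μ.real Q)
    {A : ι → Set α} (hA : ∀ i, MeasurableSet (A i)) (hd : Pairwise (Function.onFun Disjoint A))
    (hAQ : ∀ i, A i ⊆ Q)
    (hbad : ∀ i, 10 * C * √ε * μ.real (A i) ≤ ∫ x in A i, F (g x) ∂μ ∨
      C / ε * μ.real (A i) ≤ ∫ x in A i, ‖g x‖ ^ 2 ∂μ) :
    μ.real (⋃ i, A i) ≤ (1 - ε) * μ.real Q := by
  have : IsFiniteMeasure (μ.restrict Q) := ⟨by simpa using hQfin.lt_top⟩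
  have hsq : IntegrableOn (fun x => ‖g x‖ ^ 2) Q μ := hg.integrable_norm_pow two_ne_zero
  have hint : IntegrableOn g Q μ := hg.integrable one_le_two
  have hFint : IntegrableOn (fun x => F (g x)) Q μ := F.integrable_comp hint
  let I₁ := {i // 10 * C * √ε * μ.real (A i) ≤ ∫ x in A i, F (g x) ∂μ}
  let I₂ := {i // C / ε * μ.real (A i) ≤ ∫ x in A i, ‖g x‖ ^ 2 ∂μ}
  let E₁ : Set α := ⋃ i : I₁, A i
  let E₂ : Set α := ⋃ i : I₂, A i
  have hE₁Q : E₁ ⊆ Q := Set.iUnion_subset fun i => hAQ i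
  have hE₂Q : E₂ ⊆ Q := Set.iUnion_subset fun i => hAQ i
  have hE₁m : MeasurableSet E₁ := MeasurableSet.iUnion fun i => hA i
  have hfin {B : Set α} (hB : B ⊆ Q) : μ B ≠ ∞ := measure_ne_top_of_subset hB hQfin
  have hE : μ.real (⋃ i, A i) ≤ μ.real E₁ + μ.real E₂ := by
    refine (measureReal_mono ?_ (hfin (Set.union_subset hE₁Q hE₂Q))).trans
      (measureReal_union_le _ _)
    refine Set.iUnion_subset fun i => ?_
    rcases hbad i with h | h
    · exact (Set.subset_iUnion (fun i : I₁ => A i) ⟨i, h⟩).trans Set.subset_union_left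
    · exact (Set.subset_iUnion (fun i : I₂ => A i) ⟨i, h⟩).trans Set.subset_union_right
  have h₁ : 10 * C * √ε * μ.real E₁ ≤ ∫ x in E₁, F (g x) ∂μ :=
    mul_measureReal_iUnion_le (A := fun i : I₁ => A i) (fun i => hA i)
      (hd.comp_of_injective Subtype.val_injective) (hfin hE₁Q) (hFint.mono_set hE₁Q) fun i => i.2
  have h₂ : C / ε * μ.real E₂ ≤ ∫ x in E₂, ‖g x‖ ^ 2 ∂μ :=
    mul_measureReal_iUnion_le (A := fun i : I₂ => A i) (fun i => hA i)
      (hd.comp_of_injective Subtype.val_injective) (hfin hE₂Q) (hsq.mono_set hE₂Q) fun i => i.2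
  have hle {B : Set α} (hB : B ⊆ Q) : ∫ x in B, ‖g x‖ ^ 2 ∂μ ≤ C * μ.real Q :=
    (setIntegral_mono_set hsq (ae_of_all _ fun x => by positivity) hB.eventuallyLE).trans hgC
  have hE₂ : μ.real E₂ ≤ ε * μ.real Q := by
    have h := h₂.trans (hle hE₂Q)
    rw [div_mul_eq_mul_div, div_le_iff₀ hε] at h
    refine le_of_mul_le_mul_left (a := C) ?_ (by linarith)
    linarith
  by_contra! hcon
  have hq : 0 ≤ μ.real Q := measureReal_nonneg
  have hdiff : μ.real (Q \ E₁) = μ.real Q - μ.real E₁ := measureReal_sdiff hE₁Q hE₁m hQfin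
  have hsplit : ∫ x in Q, F (g x) ∂μ = ∫ x in E₁, F (g x) ∂μ + ∫ x in Q \ E₁, F (g x) ∂μ := by
    rw [setIntegral_sdiff hE₁m hFint hE₁Q]; ring
  have hR : -∫ x in Q \ E₁, F (g x) ∂μ ≤ C * √ε * μ.real Q := by
    have hsub : Q \ E₁ ⊆ Q := Set.sdiff_subset
    have : IsFiniteMeasure (μ.restrict (Q \ E₁)) := ⟨by simpa using (hfin hsub).lt_top⟩
    have hCS := sq_integral_norm_le (hg.mono_measure (Measure.restrict_mono hsub le_rfl))
    rw [measureReal_restrict_apply_univ] at hCS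
    have hnorm : -∫ x in Q \ E₁, F (g x) ∂μ ≤ ∫ x in Q \ E₁, ‖g x‖ ∂μ := by
      rw [← integral_neg]
      exact integral_mono (hFint.mono_set hsub).neg (hint.mono_set hsub).norm
        fun x => (neg_le_abs _).trans (hF _)
    refine hnorm.trans (abs_le_of_sq_le_sq' ?_ (by positivity)).2
    calc _ ≤ μ.real (Q \ E₁) * (C * μ.real Q) :=
          hCS.trans (mul_le_mul_of_nonneg_left (hle hsub) measureReal_nonneg)
      _ ≤ 2 * ε * μ.real Q * (C * μ.real Q) := by
          refine mul_le_mul_of_nonneg_right ?_ (by positivity)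
          linarith
      _ = 2 * (C * ε * μ.real Q ^ 2) := by ring
      _ ≤ C * (C * ε * μ.real Q ^ 2) := mul_le_mul_of_nonneg_right hC (by positivity)
      _ = (C * √ε * μ.real Q) ^ 2 := by rw [mul_pow, mul_pow, Real.sq_sqrt hε.le]; ring
  have hlast : C * √ε * (10 * μ.real E₁) ≤ C * √ε * (2 * μ.real Q) := by linarith
  have hE₁ := le_of_mul_le_mul_left hlast (by positivity)
  nlinarith

theorem sub_average_eq {α E : Type*} [MeasurableSpace α] {μ : Measure α} [NormedAddCommGroup E]
    [NormedSpace ℝ E] [CompleteSpace E] {Q : Set α} (hQ : 0 < (μ Q).toReal) {b : α → E}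
    (hb : IntegrableOn b Q μ) (w : E) :
    w - (μ Q).toReal⁻¹ • ∫ x in Q, b x ∂μ = (μ Q).toReal⁻¹ • ∫ x in Q, (w - b x) ∂μ := by
  have hfin : μ Q ≠ ∞ := fun h => by simp [h] at hQ
  rw [integral_sub (integrableOn_const (C := w) hfin).integrable hb, setIntegral_const, smul_sub,
    Measure.real, smul_smul, inv_mul_cancel₀ hQ.ne', one_smul]

/-- **stopping-time selection of subcubes.** For every `C ≥ 2` there is
`ε₀ ∈ (0,1)` such that for `ε ∈ (0,ε₀)`, any dyadic cube `Q`, unit vector `w ∈ ℂᵐ`,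
`b ∈ L²`, and real-linear functional `F` with `|F(v)| ≤ |v|`, if `∫_Q |w−b|² ≤ C|Q|` and
`F(w − avg_Q b) ≤ C√ε`, then `Q` contains disjoint dyadic subcubes `Q_i` with
`Σ|Q_i| ≤ (1−ε)|Q|` such that on `R(Q) ∖ ∪ R(Q_i)` we have both
`F(w − S_t b(x)) ≤ 10C√ε` and `|w − S_t b(x)| ≤ √(C/ε)`. -/
theorem stopping_time_selection (n m : ℕ) (hn : 0 < n) (hm : 0 < m) (C : ℝ) (hC : 2 ≤ C) :
    ∃ ε₀ : ℝ, 0 < ε₀ ∧ ε₀ < 1 ∧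
    ∀ ε : ℝ, 0 < ε → ε < ε₀ →
    ∀ (j : ℤ) (z : Fin n → ℤ) (w : Erng m), ‖w‖ = 1 →
    ∀ (b : HS n m) (F : Erng m →ₗ[ℝ] ℝ), (∀ v : Erng m, |F v| ≤ ‖v‖) →
    (∫⁻ x in dyCube n j z, (‖w - b x‖₊ : ℝ≥0∞) ^ 2
      ≤ ENNReal.ofReal C * volume (dyCube n j z)) →
    F (w - (volume (dyCube n j z)).toReal⁻¹ • ∫ x in dyCube n j z, b x)
      ≤ C * Real.sqrt ε →
    ∃ S : Set (ℤ × (Fin n → ℤ)),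
      (∀ p ∈ S, dyCube n p.1 p.2 ⊆ dyCube n j z) ∧
      (∀ p ∈ S, ∀ q ∈ S, p ≠ q → Disjoint (dyCube n p.1 p.2) (dyCube n q.1 q.2)) ∧
      (∑' p : S, volume (dyCube n p.1.1 p.1.2)
        ≤ ENNReal.ofReal (1 - ε) * volume (dyCube n j z)) ∧
      ∀ (x : Edom n) (t : ℝ), x ∈ dyCube n j z → t ∈ Set.Ioc (0 : ℝ) ((2 : ℝ) ^ j) →
        (x, t) ∉ ⋃ q ∈ S, carlesonBox n q.1 q.2 →
        F (w - Savg t (b : Edom n → Erng m) x) ≤ 10 * C * Real.sqrt ε ∧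
        ‖w - Savg t (b : Edom n → Erng m) x‖ ≤ Real.sqrt (C / ε) := by
  refine ⟨1 / 4, by norm_num, by norm_num, ?_⟩
  intro ε hε hε' j z w _ b F hF hbC hFQ
  obtain ⟨S, hSQ, hSd, hSP, hS⟩ := exists_maximal_dyCubes n j z fun k y =>
    ¬ (F (w - (volume (dyCube n k y)).toReal⁻¹ • ∫ x in dyCube n k y, b x) ≤ 10 * C * √ε ∧
      ‖w - (volume (dyCube n k y)).toReal⁻¹ • ∫ x in dyCube n k y, b x‖ ≤ √(C / ε))
  refine ⟨S, hSQ, hSd, ?_, fun x t hx ht hxt => not_not.1 (hS x t hx ht hxt)⟩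
  let G : Erng m →L[ℝ] ℝ := F.mkContinuous 1 fun v => by simpa using hF v
  have hfin (k : ℤ) (y : Fin n → ℤ) : IsFiniteMeasure (volume.restrict (dyCube n k y)) :=
    ⟨by simpa using (volume_dyCube_ne_top n k y).lt_top⟩
  have hg (k : ℤ) (y : Fin n → ℤ) : MemLp (fun x => w - b x) 2 (volume.restrict (dyCube n k y)) :=
    (memLp_const w).sub ((Lp.memLp b).restrict _)
  have havg (k : ℤ) (y : Fin n → ℤ) := sub_average_eq (measureReal_dyCube_pos n k y)
    (((Lp.memLp b).restrict (dyCube n k y)).integrable one_le_two) w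
  have hFavg (k : ℤ) (y : Fin n → ℤ) :
      (volume (dyCube n k y)).toReal *
        F (w - (volume (dyCube n k y)).toReal⁻¹ • ∫ x in dyCube n k y, b x) =
      ∫ x in dyCube n k y, G (w - b x) := by
    rw [G.integral_comp_comm ((hg k y).integrable one_le_two), havg, map_smul, smul_eq_mul,
      mul_inv_cancel_left₀ (measureReal_dyCube_pos n k y).ne']
    rfl
  have hgC : ∫ x in dyCube n j z, ‖w - b x‖ ^ 2 ≤ C * volume.real (dyCube n j z) := by
    rw [integral_eq_lintegral_of_nonneg_ae (ae_of_all _ fun x => by positivity)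
      ((hg j z).integrable_norm_pow two_ne_zero).aestronglyMeasurable]
    refine ENNReal.toReal_le_of_le_ofReal (by positivity) ?_
    rw [ENNReal.ofReal_mul (by linarith), ofReal_measureReal (volume_dyCube_ne_top n j z)]
    refine le_trans (le_of_eq ?_) hbC
    refine lintegral_congr fun x => ?_
    rw [ENNReal.ofReal_pow (norm_nonneg _), ofReal_norm, enorm_eq_nnnorm]
  have key := measureReal_iUnion_le_of_stopping (μ := volume) (ι := S)
    (A := fun p => dyCube n p.1.1 p.1.2)
    (volume_dyCube_ne_top n j z) (hg j z) hC hε hε' hgC G hF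
    (by rw [← hFavg, mul_comm]; exact mul_le_mul_of_nonneg_right hFQ measureReal_nonneg)
    (fun p => measurableSet_dyCube n _ _)
    (fun p q hpq => hSd p p.2 q q.2 (Subtype.coe_injective.ne hpq)) (fun p => hSQ p p.2) ?_
  · rw [← measure_iUnion (fun (p q : S) hpq => hSd p p.2 q q.2 (Subtype.coe_injective.ne hpq))
      (fun p => measurableSet_dyCube n _ _),
      ← ofReal_measureReal (volume_dyCube_ne_top n j z), ← ENNReal.ofReal_mul (by linarith)]
    exact (ENNReal.le_ofReal_iff_toReal_le (measure_ne_top_of_subset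
      (Set.iUnion_subset fun p : S => hSQ p p.2) (volume_dyCube_ne_top n j z))
      (mul_nonneg (by linarith) measureReal_nonneg)).2 key
  · rintro ⟨⟨k, y⟩, hp⟩
    have hpos := measureReal_dyCube_pos n k y
    rcases not_and_or.1 (hSP _ hp) with h | h
    · left
      rw [← hFavg, mul_comm]
      exact mul_le_mul_of_nonneg_left (not_le.1 h).le hpos.le
    · right
      have hCS := sq_integral_norm_le (hg k y)
      rw [measureReal_restrict_apply_univ] at hCS
      simp only [havg, norm_smul, norm_inv, Real.norm_of_nonneg hpos.le, not_le] at h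
      have h1 := h.trans_le (mul_le_mul_of_nonneg_left (norm_integral_le_integral_norm _)
        (inv_nonneg.2 hpos.le))
      have h2 := (Real.sqrt_lt' ((Real.sqrt_nonneg _).trans_lt h1)).1 h1
      rw [mul_pow, inv_pow, inv_mul_eq_div, lt_div_iff₀ (by positivity)] at h2
      refine le_of_mul_le_mul_left (a := (volume (dyCube n k y)).toReal) ?_ hpos
      calc _ = C / ε * (volume (dyCube n k y)).toReal ^ 2 := by rw [Measure.real]; ring
        _ ≤ _ := h2.le.trans hCS
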